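/- For every λ ∈ [0,1] and every nonnegative progressively measurable process c, the following identity holds for every nonnegative progressively measurable process δ: ⟨c ∨ λc̄, δ⟩ = sup{⟨c,δ̃⟩ : δ̃ nonnegative progressively measurable with δ̃ ⪯_λ δ}. -/

import Mathlib

open MeasureTheory ENNReal Filter Set

noncomputable section

/-- The time interval `[0, T̂)` for a horizon `T̂ ∈ (0,∞]`, encoded as an `EReal`. -/
def timeSet (That : EReal) : Set ℝ := {t : ℝ | 0 ≤ t ∧ (t : EReal) < That}

/-- Running essential supremum (w.r.t. Lebesgue measure) of an `[0,∞]`-valued function: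
`f̄ 0 = 0` and `f̄ t = essSup of f over [0,t]` for `t > 0`. -/
def runEssSupE (f : ℝ → ℝ≥0∞) (t : ℝ) : ℝ≥0∞ :=
  if t = 0 then 0 else essSup f (volume.restrict (Set.Icc (0:ℝ) t))

/-- Running essential supremum of a nonnegative real-valued function, valued in `[0,∞]`. -/
def runEssSup (f : ℝ → ℝ) (t : ℝ) : ℝ≥0∞ :=
  runEssSupE (fun s => ENNReal.ofReal (f s)) t

variable {Ω : Type*}

/-- The measure `P ⊗ dκ` on `Ω × [0,T̂)`. -/
def Pkappa [MeasurableSpace Ω] (P : Measure Ω) (That : EReal) (kdot : Ω → ℝ → ℝ) :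
    Measure (Ω × ℝ) :=
  (P.prod (volume.restrict (timeSet That))).withDensity fun p => ENNReal.ofReal (kdot p.1 p.2)

/-- `E[∫_0^T̂ c_t δ_t dκ_t]` for an `[0,∞]`-valued process `c` and a real process `δ`. -/
def pairE [MeasurableSpace Ω] (P : Measure Ω) (That : EReal) (kdot : Ω → ℝ → ℝ)
    (c : Ω → ℝ → ℝ≥0∞) (δ : Ω → ℝ → ℝ) : ℝ≥0∞ :=
  ∫⁻ ω, ∫⁻ t in timeSet That,
    c ω t * ENNReal.ofReal (δ ω t) * ENNReal.ofReal (kdot ω t) ∂volume ∂P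

/-- `⟨c, δ⟩ = E[∫_0^T̂ c_t δ_t dκ_t]` for real-valued processes. -/
def pairR [MeasurableSpace Ω] (P : Measure Ω) (That : EReal) (kdot : Ω → ℝ → ℝ)
    (c δ : Ω → ℝ → ℝ) : ℝ≥0∞ :=
  pairE P That kdot (fun ω t => ENNReal.ofReal (c ω t)) δ

/-- A stopping time with values in `[0,T̂]` for the filtration `(F_t)`. -/
def IsStopTime {m : MeasurableSpace Ω} (ℱ : Filtration ℝ m) (That : EReal)
    (T : Ω → EReal) : Prop :=
  (∀ ω, 0 ≤ T ω ∧ T ω ≤ That) ∧ ∀ t : ℝ, MeasurableSet[ℱ t] {ω | T ω ≤ (t : EReal)}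

/-- `E[∫_T^T̂ δ_t dκ_t]` for a stopping time `T`. -/
def tailInt [MeasurableSpace Ω] (P : Measure Ω) (That : EReal) (kdot : Ω → ℝ → ℝ)
    (δ : Ω → ℝ → ℝ) (T : Ω → EReal) : ℝ≥0∞ :=
  ∫⁻ ω, ∫⁻ t in timeSet That ∩ {t : ℝ | T ω ≤ (t : EReal)},
    ENNReal.ofReal (δ ω t) * ENNReal.ofReal (kdot ω t) ∂volume ∂P

/-- The chronological ordering `δ' ⪯ δ`:
`E[∫_T^T̂ δ' dκ] ≤ E[∫_T^T̂ δ dκ]` for every stopping time `T` with values in `[0,T̂]`. -/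
def chronLE {m : MeasurableSpace Ω} (P : Measure Ω) (That : EReal) (kdot : Ω → ℝ → ℝ)
    (ℱ : Filtration ℝ m) (δ' δ : Ω → ℝ → ℝ) : Prop :=
  ∀ T : Ω → EReal, IsStopTime ℱ That T →
    tailInt P That kdot δ' T ≤ tailInt P That kdot δ T

/-- The interpolated ordering `δ' ⪯_λ δ`: there are decompositions `δ = δ¹ + δ²`,
`δ' = δ'¹ + δ'²` into nonnegative progressively measurable processes with
`δ'¹ ≤ δ¹` `P⊗dκ`-a.e. and `δ'² ⪯ λδ²`. -/
def chronLElam {m : MeasurableSpace Ω} (P : Measure Ω) (That : EReal) (kdot : Ω → ℝ → ℝ)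
    (ℱ : Filtration ℝ m) (lam : ℝ) (δ' δ : Ω → ℝ → ℝ) : Prop :=
  ∃ δ₁ δ₂ δ'₁ δ'₂ : Ω → ℝ → ℝ,
    (∀ ω t, 0 ≤ δ₁ ω t) ∧ (∀ ω t, 0 ≤ δ₂ ω t) ∧
    (∀ ω t, 0 ≤ δ'₁ ω t) ∧ (∀ ω t, 0 ≤ δ'₂ ω t) ∧
    ProgMeasurable ℱ (fun t ω => δ₁ ω t) ∧ ProgMeasurable ℱ (fun t ω => δ₂ ω t) ∧
    ProgMeasurable ℱ (fun t ω => δ'₁ ω t) ∧ ProgMeasurable ℱ (fun t ω => δ'₂ ω t) ∧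
    (∀ ω t, δ ω t = δ₁ ω t + δ₂ ω t) ∧ (∀ ω t, δ' ω t = δ'₁ ω t + δ'₂ ω t) ∧
    (∀ᵐ p ∂(Pkappa P That kdot), δ'₁ p.1 p.2 ≤ δ₁ p.1 p.2) ∧
    chronLE P That kdot ℱ δ'₂ (fun ω t => lam * δ₂ ω t)

/-- The progressive `σ`-algebra on `Ω × ℝ` of a filtration indexed by `ℝ`. -/
abbrev progSigma {m : MeasurableSpace Ω} (ℱ : Filtration ℝ m) : MeasurableSpace (Ω × ℝ) :=
  ⨅ t : ℝ, MeasurableSpace.map (fun p : Iic t × Ω => (p.2, (p.1 : ℝ)))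
    (@Prod.instMeasurableSpace (Iic t) Ω _ (ℱ t))

lemma measurableSet_progSigma_iff {m : MeasurableSpace Ω} {ℱ : Filtration ℝ m}
    {B : Set (Ω × ℝ)} : MeasurableSet[progSigma ℱ] B ↔
      ∀ t : ℝ, MeasurableSet[@Prod.instMeasurableSpace (Iic t) Ω _ (ℱ t)]
        ((fun p : Iic t × Ω => (p.2, (p.1 : ℝ))) ⁻¹' B) := by
  rw [progSigma, MeasurableSpace.measurableSet_iInf]
  rfl

lemma isStronglyProgressive_iff_measurable_progSigma {m : MeasurableSpace Ω}
    {ℱ : Filtration ℝ m} {u : Ω → ℝ → ℝ} :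
    IsStronglyProgressive ℱ (fun t ω => u ω t) ↔
      Measurable[progSigma ℱ] (fun p : Ω × ℝ => u p.1 p.2) := by
  constructor
  · intro h s hs
    rw [measurableSet_progSigma_iff]
    intro t
    exact (h t).measurable hs
  · intro h t
    refine Measurable.stronglyMeasurable ?_
    intro s hs
    exact measurableSet_progSigma_iff.1 (h hs) t

lemma progSigma_le {m : MeasurableSpace Ω} (ℱ : Filtration ℝ m) :
    progSigma ℱ ≤ (Prod.instMeasurableSpace : MeasurableSpace (Ω × ℝ)) := by
  intro B hB
  rw [measurableSet_progSigma_iff] at hB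
  have key : ∀ n : ℕ, MeasurableSet {p : Ω × ℝ | (p.1, min p.2 n) ∈ B} := by
    intro n
    have h1 : MeasurableSet ((fun p : Iic (n : ℝ) × Ω => (p.2, (p.1 : ℝ))) ⁻¹' B) :=
      sup_le_sup le_rfl (MeasurableSpace.comap_mono (ℱ.le n)) _ (hB n)
    have h2 : Measurable
        (fun p : Ω × ℝ => ((⟨min p.2 n, mem_Iic.2 (min_le_right _ _)⟩ : Iic (n : ℝ)), p.1)) :=
      ((measurable_snd.min measurable_const).subtype_mk).prodMk measurable_fst
    exact h2 h1
  have : B = ⋃ n : ℕ, ({p : Ω × ℝ | (p.1, min p.2 n) ∈ B} ∩ {p | p.2 ≤ n}) := by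
    ext ⟨ω, t⟩
    simp only [mem_iUnion, mem_inter_iff, mem_ofPred_eq]
    constructor
    · intro h
      obtain ⟨n, hn⟩ := exists_nat_ge t
      exact ⟨n, by rwa [min_eq_left hn], hn⟩
    · rintro ⟨n, h, hn⟩
      rwa [min_eq_left hn] at h
  rw [this]
  exact MeasurableSet.iUnion fun n => (key n).inter (measurableSet_le measurable_snd measurable_const)

lemma measurableSet_progSigma_prod_Ici {m : MeasurableSpace Ω} {ℱ : Filtration ℝ m}
    {q : ℝ} {F : Set Ω} (hF : MeasurableSet[ℱ q] F) :
    MeasurableSet[progSigma ℱ] (F ×ˢ Ici q) := by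
  rw [measurableSet_progSigma_iff]
  intro t
  by_cases hqt : q ≤ t
  · let _ : MeasurableSpace Ω := ℱ t
    have h1 : MeasurableSet {p : Iic t × Ω | q ≤ (p.1 : ℝ)} :=
      measurableSet_le measurable_const (measurable_subtype_coe.comp measurable_fst)
    have h2 : MeasurableSet {p : Iic t × Ω | p.2 ∈ F} := measurable_snd (ℱ.mono hqt _ hF)
    exact h2.inter h1
  · convert MeasurableSet.empty
    ext ⟨⟨s, hs⟩, ω⟩
    simp only [mem_preimage, mem_prod, mem_Ici, mem_empty_iff_false, iff_false, not_and]
    exact fun _ h => hqt (h.trans hs)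

lemma IsStopTime.measurableSet_progSigma {m : MeasurableSpace Ω} {ℱ : Filtration ℝ m}
    {That : EReal} {T : Ω → EReal} (hT : IsStopTime ℱ That T) :
    MeasurableSet[progSigma ℱ] {p : Ω × ℝ | T p.1 ≤ (p.2 : EReal)} := by
  rw [measurableSet_progSigma_iff]
  intro t
  let _ : MeasurableSpace Ω := ℱ t
  have hlt : ∀ q : ℝ, q ≤ t → MeasurableSet {p : Iic t × Ω | (q : EReal) < T p.2} := by
    intro q hq
    have : MeasurableSet {ω | T ω ≤ (q : EReal)} := ℱ.mono hq _ (hT.2 q)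
    have h2 : MeasurableSet {ω | (q : EReal) < T ω} := by
      convert this.compl using 1
      ext ω; simp
    exact measurable_snd h2
  have hcoe : Measurable fun p : Iic t × Ω => (p.1 : ℝ) :=
    measurable_subtype_coe.comp measurable_fst
  have h1 : MeasurableSet (⋃ q : ℚ, {p : Iic t × Ω | (p.1 : ℝ) < q ∧ (q : ℝ) ≤ t ∧
      ((q : ℝ) : EReal) < T p.2}) := by
    refine MeasurableSet.iUnion fun q => ?_
    by_cases hq : (q : ℝ) ≤ t
    · simp only [hq, true_and]
      exact (measurableSet_lt hcoe measurable_const).inter (hlt q hq)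
    · simp [hq]
  have h2 : MeasurableSet {p : Iic t × Ω | (p.1 : ℝ) = t ∧ (t : EReal) < T p.2} :=
    (measurableSet_eq_fun hcoe measurable_const).inter (hlt t le_rfl)
  convert (h1.union h2).compl using 1
  ext ⟨⟨s, hs⟩, ω⟩
  simp only [mem_preimage, mem_ofPred_eq, compl_union, mem_inter_iff, mem_compl_iff, mem_iUnion,
    not_exists, not_and, not_lt]
  constructor
  · intro h
    refine ⟨fun q hsq hq => h.trans (EReal.coe_le_coe_iff.2 hsq.le), ?_⟩
    rintro rfl
    exact h
  · rintro ⟨h1, h2⟩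
    rcases eq_or_lt_of_le (show s ≤ t from hs) with rfl | hst
    · exact h2 rfl
    · by_contra! hlt
      obtain ⟨q, hq1, hq2⟩ := EReal.lt_iff_exists_rat_btwn.1
        (lt_min hlt (EReal.coe_lt_coe_iff.2 hst))
      have hq3 := lt_min_iff.1 hq2
      have e1 : s < (q : ℝ) := by exact_mod_cast hq1
      have e2 : (q : ℝ) < t := by exact_mod_cast hq3.2
      exact absurd hq3.1 (not_lt.2 (h1 q e1 e2.le))

lemma lt_runEssSupE_iff {f : ℝ → ℝ≥0∞} {x : ℝ≥0∞} {t : ℝ} :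
    x < runEssSupE f t ↔ 0 < volume ({s | x < f s} ∩ Icc 0 t) := by
  unfold runEssSupE
  split_ifs with ht
  · subst ht
    simp only [not_lt_zero, Icc_self, false_iff, not_lt, nonpos_iff_eq_zero]
    exact measure_mono_null inter_subset_right (by simp)
  · rw [pos_iff_ne_zero, ← Measure.restrict_apply' measurableSet_Icc, ← not_le, not_iff_not]
    constructor
    · intro h
      have := ENNReal.ae_le_essSup (μ := volume.restrict (Icc 0 t)) f
      have h2 : ∀ᵐ s ∂volume.restrict (Icc 0 t), f s ≤ x := this.mono fun s hs => hs.trans h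
      rw [ae_iff] at h2
      simpa using h2
    · intro h
      refine essSup_le_of_ae_le x ?_
      rw [EventuallyLE, ae_iff]
      simpa using h

lemma monotone_runEssSupE (f : ℝ → ℝ≥0∞) : Monotone (runEssSupE f) := by
  intro s t hst
  refine le_of_forall_lt fun x hx => ?_
  rw [lt_runEssSupE_iff] at hx ⊢
  exact hx.trans_le (measure_mono (inter_subset_inter_right _ (Icc_subset_Icc_right hst)))

lemma lt_runEssSupE_iff_exists_rat {f : ℝ → ℝ≥0∞} {x : ℝ≥0∞} {t : ℝ} :
    x < runEssSupE f t ↔ ∃ q : ℚ, (q : ℝ) < t ∧ x < runEssSupE f q := by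
  refine ⟨fun h => ?_, fun ⟨q, hq, h⟩ => h.trans_le (monotone_runEssSupE f hq.le)⟩
  by_contra! hcon
  rw [lt_runEssSupE_iff] at h
  refine h.ne' (measure_mono_null (t := (⋃ q : {q : ℚ // (q : ℝ) < t},
    ({s | x < f s} ∩ Icc 0 (q : ℝ))) ∪ {t}) ?_ ?_)
  · rintro s ⟨hs, hs0, hst⟩
    rcases eq_or_lt_of_le hst with rfl | hlt
    · simp
    · obtain ⟨q, hq1, hq2⟩ := exists_rat_btwn hlt
      exact Or.inl (mem_iUnion.2 ⟨⟨q, hq2⟩, hs, hs0, hq1.le⟩)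
  · refine measure_union_null (measure_iUnion_null fun q => ?_) (by simp)
    have := (lt_runEssSupE_iff (f := f) (x := x) (t := q)).not.1 (hcon q.1 q.2).not_gt
    simpa using this

lemma measurableSet_lt_runEssSup {m : MeasurableSpace Ω} {ℱ : Filtration ℝ m}
    {c : Ω → ℝ → ℝ} (hc : IsStronglyProgressive ℱ (fun t ω => c ω t)) (x : ℝ≥0∞) (q : ℝ) :
    MeasurableSet[ℱ q] {ω | x < runEssSup (c ω) q} := by
  let _ : MeasurableSpace Ω := ℱ q
  have hmap : Measurable
      (fun p : ℝ × Ω => ((⟨min p.1 q, mem_Iic.2 (min_le_right _ _)⟩ : Iic q), p.2)) :=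
    ((measurable_fst.min measurable_const).subtype_mk).prodMk measurable_snd
  have hS : MeasurableSet
      {p : ℝ × Ω | x < ENNReal.ofReal (c p.2 (min p.1 q)) ∧ p.1 ∈ Icc 0 q} :=
    (measurableSet_lt measurable_const ((hc q).measurable.comp hmap).ennreal_ofReal).inter
      (measurable_fst measurableSet_Icc)
  convert measurableSet_lt (measurable_const (a := (0 : ℝ≥0∞)))
    (measurable_measure_prodMk_right (μ := volume) hS) using 1
  ext ω
  simp only [mem_ofPred_eq, runEssSup, lt_runEssSupE_iff]
  congr! 2
  ext s
  simp only [mem_inter_iff, mem_ofPred_eq, mem_preimage]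
  refine and_congr_left fun hs => ?_
  rw [min_eq_left hs.2]

lemma measurable_progSigma_runEssSup {m : MeasurableSpace Ω} {ℱ : Filtration ℝ m}
    {c : Ω → ℝ → ℝ} (hc : IsStronglyProgressive ℱ (fun t ω => c ω t)) :
    Measurable[progSigma ℱ] (fun p : Ω × ℝ => runEssSup (c p.1) p.2) := by
  let _ := progSigma ℱ
  refine measurable_of_Ioi fun x => ?_
  have : (fun p : Ω × ℝ => runEssSup (c p.1) p.2) ⁻¹' Ioi x =
      ⋃ q : ℚ, {ω | x < runEssSup (c ω) q} ×ˢ Ici (q : ℝ) := by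
    ext ⟨ω, t⟩
    simp only [mem_preimage, mem_Ioi, mem_iUnion, mem_prod, mem_ofPred_eq, mem_Ici]
    constructor
    · intro h
      obtain ⟨q, hq, h⟩ := lt_runEssSupE_iff_exists_rat.1 h
      exact ⟨q, h, hq.le⟩
    · rintro ⟨q, h, hq⟩
      exact h.trans_le (monotone_runEssSupE _ hq)
  rw [this]
  exact MeasurableSet.iUnion fun q =>
    measurableSet_progSigma_prod_Ici (measurableSet_lt_runEssSup hc x q)

lemma measurableSet_timeSet (That : EReal) : MeasurableSet (timeSet That) :=
  (measurableSet_le measurable_const measurable_id).inter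
    (measurableSet_lt measurable_coe_real_ereal measurable_const)

lemma lintegral_Pkappa [MeasurableSpace Ω] (P : Measure Ω) (That : EReal) {kdot : Ω → ℝ → ℝ}
    (hk : Measurable fun p : Ω × ℝ => kdot p.1 p.2) {g : Ω × ℝ → ℝ≥0∞} (hg : Measurable g) :
    ∫⁻ p, g p ∂(Pkappa P That kdot) =
      ∫⁻ ω, ∫⁻ t in timeSet That, g (ω, t) * ENNReal.ofReal (kdot ω t) ∂volume ∂P := by
  rw [Pkappa, lintegral_withDensity_eq_lintegral_mul _ hk.ennreal_ofReal hg,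
    lintegral_prod _ (hk.ennreal_ofReal.mul hg).aemeasurable]
  simp only [Pi.mul_apply, mul_comm]

lemma setLIntegral_Pkappa [MeasurableSpace Ω] (P : Measure Ω) (That : EReal)
    {kdot : Ω → ℝ → ℝ} (hk : Measurable fun p : Ω × ℝ => kdot p.1 p.2)
    {g : Ω × ℝ → ℝ≥0∞} (hg : Measurable g) {S : Set (Ω × ℝ)} (hS : MeasurableSet S) :
    ∫⁻ p in S, g p ∂(Pkappa P That kdot) =
      ∫⁻ ω, ∫⁻ t in timeSet That ∩ {t | (ω, t) ∈ S},
        g (ω, t) * ENNReal.ofReal (kdot ω t) ∂volume ∂P := by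
  rw [← lintegral_indicator hS, lintegral_Pkappa P That hk (hg.indicator hS)]
  refine lintegral_congr fun ω => ?_
  have hSω : MeasurableSet {t | (ω, t) ∈ S} := measurable_prodMk_left hS
  rw [inter_comm, ← Measure.restrict_restrict hSω, ← lintegral_indicator hSω]
  refine lintegral_congr fun t => ?_
  by_cases h : (ω, t) ∈ S <;> simp [h]

lemma pairE_eq_lintegral_Pkappa [MeasurableSpace Ω] (P : Measure Ω) (That : EReal)
    {kdot : Ω → ℝ → ℝ} (hk : Measurable fun p : Ω × ℝ => kdot p.1 p.2)
    {c : Ω → ℝ → ℝ≥0∞} (hc : Measurable fun p : Ω × ℝ => c p.1 p.2)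
    {δ : Ω → ℝ → ℝ} (hδ : Measurable fun p : Ω × ℝ => δ p.1 p.2) :
    pairE P That kdot c δ =
      ∫⁻ p, c p.1 p.2 * ENNReal.ofReal (δ p.1 p.2) ∂(Pkappa P That kdot) :=
  (lintegral_Pkappa P That hk (hc.mul hδ.ennreal_ofReal)).symm

lemma pairR_add [MeasurableSpace Ω] (P : Measure Ω) (That : EReal)
    {kdot : Ω → ℝ → ℝ} (hk : Measurable fun p : Ω × ℝ => kdot p.1 p.2)
    {c : Ω → ℝ → ℝ} (hc : Measurable fun p : Ω × ℝ => c p.1 p.2)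
    {δ₁ δ₂ : Ω → ℝ → ℝ} (m₁ : Measurable fun p : Ω × ℝ => δ₁ p.1 p.2)
    (m₂ : Measurable fun p : Ω × ℝ => δ₂ p.1 p.2) (h₁ : ∀ ω t, 0 ≤ δ₁ ω t)
    (h₂ : ∀ ω t, 0 ≤ δ₂ ω t) :
    pairR P That kdot c (fun ω t => δ₁ ω t + δ₂ ω t) =
      pairR P That kdot c δ₁ + pairR P That kdot c δ₂ := by
  simp only [pairR]
  rw [pairE_eq_lintegral_Pkappa P That hk hc.ennreal_ofReal (m₁.add m₂),
    pairE_eq_lintegral_Pkappa P That hk hc.ennreal_ofReal m₁,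
    pairE_eq_lintegral_Pkappa P That hk hc.ennreal_ofReal m₂,
    ← lintegral_add_left (by fun_prop)]
  refine lintegral_congr fun p => ?_
  rw [ENNReal.ofReal_add (h₁ _ _) (h₂ _ _), mul_add]

lemma IsStopTime.tailInt_eq {m : MeasurableSpace Ω} {ℱ : Filtration ℝ m} {That : EReal}
    {T : Ω → EReal} (hT : IsStopTime ℱ That T) (P : Measure Ω)
    {kdot : Ω → ℝ → ℝ} (hk : Measurable fun p : Ω × ℝ => kdot p.1 p.2)
    {δ : Ω → ℝ → ℝ} (hδ : Measurable fun p : Ω × ℝ => δ p.1 p.2) :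
    tailInt P That kdot δ T =
      ∫⁻ p in {p : Ω × ℝ | T p.1 ≤ (p.2 : EReal)}, ENNReal.ofReal (δ p.1 p.2)
        ∂(Pkappa P That kdot) :=
  (setLIntegral_Pkappa P That hk hδ.ennreal_ofReal
    (progSigma_le ℱ _ hT.measurableSet_progSigma)).symm

/-- Layer-cake comparison of integrals. -/
lemma lintegral_le_lintegral_of_measure_lt_le {α : Type*} [MeasurableSpace α]
    {μ ν : Measure α} [SFinite μ] [SFinite ν] {f : α → ℝ≥0∞} (hf : Measurable f)
    (h : ∀ x : ℝ≥0∞, μ {a | x < f a} ≤ ν {a | x < f a}) :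
    ∫⁻ a, f a ∂μ ≤ ∫⁻ a, f a ∂ν := by
  have hlayer : ∀ a, f a = ∫⁻ x in Ioi (0 : ℝ), {y : ℝ | ENNReal.ofReal y < f a}.indicator 1 x := by
    intro a
    have hm : MeasurableSet {y : ℝ | ENNReal.ofReal y < f a} :=
      measurableSet_lt ENNReal.measurable_ofReal measurable_const
    rw [lintegral_indicator_one hm, Measure.restrict_apply hm]
    rcases eq_or_ne (f a) ⊤ with h | h
    · simp [h, Set.ofPred_true]
    · have : {y : ℝ | ENNReal.ofReal y < f a} ∩ Ioi 0 = Ioo 0 (f a).toReal := by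
        ext y
        simp only [mem_inter_iff, mem_ofPred_eq, mem_Ioi, mem_Ioo]
        rw [and_comm]
        refine and_congr_right fun hy => ENNReal.ofReal_lt_iff_lt_toReal hy.le h
      rw [this, Real.volume_Ioo, sub_zero, ENNReal.ofReal_toReal h]
  have hjoint : MeasurableSet {q : α × ℝ | ENNReal.ofReal q.2 < f q.1} :=
    measurableSet_lt measurable_snd.ennreal_ofReal (hf.comp measurable_fst)
  have hswap : ∀ (η : Measure α) [SFinite η], ∫⁻ a, f a ∂η =
      ∫⁻ x in Ioi (0 : ℝ), η {a | ENNReal.ofReal x < f a} := by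
    intro η _
    rw [lintegral_congr hlayer, lintegral_lintegral_swap]
    · refine lintegral_congr fun x => ?_
      rw [← lintegral_indicator_one (measurableSet_lt measurable_const hf)]
      rfl
    · exact ((measurable_one (α := ℝ≥0∞)).indicator hjoint).aemeasurable
  rw [hswap μ, hswap ν]
  exact lintegral_mono fun x => h _

/-- A function on `[0, ∞)` is a.e. dominated by its running essential supremum. -/
lemma ae_le_runEssSupE (f : ℝ → ℝ≥0∞) :
    ∀ᵐ t : ℝ, 0 ≤ t → f t ≤ runEssSupE f t := by
  have h1 : ∀ q : ℚ, ∀ᵐ t : ℝ, t ∈ Icc (0 : ℝ) q → f t ≤ runEssSupE f q := by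
    intro q
    rw [ae_iff]
    by_contra hne
    have : runEssSupE f q < runEssSupE f q := by
      rw [lt_runEssSupE_iff (x := runEssSupE f q)]
      refine lt_of_lt_of_le (pos_iff_ne_zero.2 hne) (measure_mono ?_)
      intro t ht
      simp only [mem_ofPred_eq, Classical.not_imp, not_le] at ht
      exact ⟨ht.2, ht.1⟩
    exact lt_irrefl _ this
  have h2 : ∀ᵐ t : ℝ, ContinuousAt (runEssSupE f) t := by
    rw [ae_iff]
    exact (monotone_runEssSupE f).countable_not_continuousAt.measure_zero _
  filter_upwards [ae_all_iff.2 h1, h2] with t ht hcont h0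
  refine ge_of_tendsto (hcont.tendsto.mono_left (nhdsWithin_le_nhds (s := Ioi t))) ?_
  filter_upwards [self_mem_nhdsWithin] with u hu
  obtain ⟨q, hq1, hq2⟩ := exists_rat_btwn (show t < u from hu)
  exact (ht q ⟨h0, hq1.le⟩).trans (monotone_runEssSupE f hq2.le)

/-- The first time, capped at `That`, at which the running essential supremum of `c`
exceeds the level `x`. -/
def runHit (That : EReal) (c : Ω → ℝ → ℝ) (x : ℝ≥0∞) (ω : Ω) : EReal :=
  min That (sInf ((↑) '' {s : ℝ | x < runEssSup (c ω) s}))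

lemma runHit_lt_iff {That : EReal} {c : Ω → ℝ → ℝ} {x : ℝ≥0∞} {ω : Ω} {t : ℝ} :
    runHit That c x ω < t ↔ That < t ∨ x < runEssSup (c ω) t := by
  rw [runHit, min_lt_iff, sInf_lt_iff]
  refine or_congr_right ⟨?_, fun h => ?_⟩
  · rintro ⟨_, ⟨s, hs, rfl⟩, hst⟩
    exact lt_of_lt_of_le hs (monotone_runEssSupE _ (EReal.coe_lt_coe_iff.1 hst).le)
  · obtain ⟨q, hq, h⟩ := lt_runEssSupE_iff_exists_rat.1 h
    exact ⟨_, ⟨q, h, rfl⟩, EReal.coe_lt_coe_iff.2 hq⟩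

lemma isStopTime_runHit {m : MeasurableSpace Ω} {ℱ : Filtration ℝ m}
    (hrc : ∀ t : ℝ, ℱ t = ⨅ s ∈ Set.Ioi t, ℱ s) {That : EReal} (hThat : 0 ≤ That)
    {c : Ω → ℝ → ℝ} (hc : IsStronglyProgressive ℱ (fun t ω => c ω t)) (x : ℝ≥0∞) :
    IsStopTime ℱ That (runHit That c x) := by
  refine ⟨fun ω => ⟨le_min hThat (le_sInf ?_), min_le_left _ _⟩, fun t => ?_⟩
  · rintro _ ⟨s, hs, rfl⟩
    by_contra! hneg
    have hneg' : s < 0 := by exact_mod_cast hneg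
    rw [mem_ofPred_eq, runEssSup, lt_runEssSupE_iff, Icc_eq_empty hneg'.not_ge] at hs
    simp at hs
  · rw [hrc t]
    simp only [MeasurableSpace.measurableSet_iInf]
    intro s hs
    have hlt : ∀ u : ℝ, MeasurableSet[ℱ u] {ω | runHit That c x ω < u} := by
      intro u
      simp only [runHit_lt_iff]
      exact (MeasurableSet.const _).union (measurableSet_lt_runEssSup hc x u)
    obtain ⟨u, -, hu, hlim⟩ := exists_seq_strictAnti_tendsto' (mem_Ioi.1 hs)
    have : {ω | runHit That c x ω ≤ (t : EReal)} = ⋂ n, {ω | runHit That c x ω < u n} := by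
      ext ω
      simp only [mem_ofPred_eq, mem_iInter]
      refine ⟨fun h n => h.trans_lt (EReal.coe_lt_coe_iff.2 (hu n).1), fun h => ?_⟩
      exact ge_of_tendsto' ((continuous_coe_real_ereal.tendsto t).comp hlim) fun n => (h n).le
    rw [this]
    exact MeasurableSet.iInter fun n => ℱ.mono (hu n).2.le _ (hlt (u n))

lemma tailInt_runHit [MeasurableSpace Ω] (P : Measure Ω) (That : EReal)
    {kdot : Ω → ℝ → ℝ} (hk : Measurable fun p : Ω × ℝ => kdot p.1 p.2)
    {c δ : Ω → ℝ → ℝ} (hc : Measurable fun p : Ω × ℝ => runEssSup (c p.1) p.2)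
    (hδ : Measurable fun p : Ω × ℝ => δ p.1 p.2) (x : ℝ≥0∞) :
    tailInt P That kdot δ (runHit That c x) =
      ((Pkappa P That kdot).withDensity fun p => ENNReal.ofReal (δ p.1 p.2))
        {p | x < runEssSup (c p.1) p.2} := by
  have hS : MeasurableSet {p : Ω × ℝ | x < runEssSup (c p.1) p.2} :=
    measurableSet_lt measurable_const hc
  rw [withDensity_apply _ hS, setLIntegral_Pkappa P That hk hδ.ennreal_ofReal hS, tailInt]
  refine lintegral_congr fun ω => setLIntegral_congr ?_
  have : ∀ᵐ t : ℝ, (t : EReal) ≠ runHit That c x ω := by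
    rw [ae_iff]
    refine Set.Subsingleton.measure_zero ?_ _
    intro s hs t ht
    simp only [ne_eq, not_not, mem_ofPred_eq] at hs ht
    exact EReal.coe_injective (hs.trans ht.symm)
  filter_upwards [this] with t ht
  refine propext (and_congr_right fun hmem => ?_)
  change runHit That c x ω ≤ t ↔ x < runEssSup (c ω) t
  rw [le_iff_lt_or_eq, or_iff_left ht.symm, runHit_lt_iff, or_iff_right hmem.2.not_gt]

lemma pairR_le_of_chronLElam {m : MeasurableSpace Ω} (P : Measure Ω) [IsProbabilityMeasure P]
    (ℱ : Filtration ℝ m) (hrc : ∀ t : ℝ, ℱ t = ⨅ s ∈ Set.Ioi t, ℱ s)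
    (That : EReal) (hThat : 0 ≤ That)
    {kdot : Ω → ℝ → ℝ} (hk : Measurable fun p : Ω × ℝ => kdot p.1 p.2)
    {lam : ℝ} (hlam : 0 ≤ lam) {c : Ω → ℝ → ℝ}
    (hc : IsStronglyProgressive ℱ (fun t ω => c ω t)) {δ δ' : Ω → ℝ → ℝ}
    (hδ : IsStronglyProgressive ℱ (fun t ω => δ ω t))
    (h : chronLElam P That kdot ℱ lam δ' δ) :
    pairR P That kdot c δ' ≤ pairE P That kdot
      (fun ω t => max (ENNReal.ofReal (c ω t)) (ENNReal.ofReal lam * runEssSup (c ω) t)) δ := by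
  obtain ⟨δ₁, δ₂, δ'₁, δ'₂, h1, h2, h1', h2', m1, m2, m1', m2', hsum, hsum', hle, hchron⟩ := h
  have toM : ∀ {u : Ω → ℝ → ℝ}, IsStronglyProgressive ℱ (fun t ω => u ω t) →
      Measurable fun p : Ω × ℝ => u p.1 p.2 := fun hu =>
    (isStronglyProgressive_iff_measurable_progSigma.1 hu).mono (progSigma_le ℱ) le_rfl
  have hcm := toM hc
  have hcbar : Measurable fun p : Ω × ℝ => runEssSup (c p.1) p.2 :=
    (measurable_progSigma_runEssSup hc).mono (progSigma_le ℱ) le_rfl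
  have : SFinite (Pkappa P That kdot) := by unfold Pkappa; infer_instance
  have e1 : pairR P That kdot c δ' = pairR P That kdot c δ'₁ + pairR P That kdot c δ'₂ := by
    rw [← pairR_add P That hk hcm (toM m1') (toM m2') h1' h2']
    simp only [← hsum']
  have e2 : pairR P That kdot c δ'₁ ≤ pairR P That kdot c δ₁ := by
    unfold pairR
    rw [pairE_eq_lintegral_Pkappa P That hk hcm.ennreal_ofReal (toM m1'),
      pairE_eq_lintegral_Pkappa P That hk hcm.ennreal_ofReal (toM m1)]
    refine lintegral_mono_ae (hle.mono fun p hp => ?_)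
    gcongr
  have e3 : pairR P That kdot c δ'₂ ≤
      pairE P That kdot (fun ω t => runEssSup (c ω) t) δ'₂ := by
    refine lintegral_mono fun ω => lintegral_mono_ae ?_
    refine (ae_restrict_iff' (measurableSet_timeSet That)).2 ?_
    filter_upwards [ae_le_runEssSupE fun s => ENNReal.ofReal (c ω s)] with t ht hmem
    gcongr
    exact ht hmem.1
  have e4 : pairE P That kdot (fun ω t => runEssSup (c ω) t) δ'₂ ≤
      pairE P That kdot (fun ω t => runEssSup (c ω) t) (fun ω t => lam * δ₂ ω t) := by
    have aux : ∀ {u : Ω → ℝ → ℝ}, (Measurable fun p : Ω × ℝ => u p.1 p.2) →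
        pairE P That kdot (fun ω t => runEssSup (c ω) t) u = ∫⁻ p, runEssSup (c p.1) p.2
          ∂((Pkappa P That kdot).withDensity fun p => ENNReal.ofReal (u p.1 p.2)) := by
      intro u hu
      rw [pairE_eq_lintegral_Pkappa P That hk hcbar hu,
        lintegral_withDensity_eq_lintegral_mul _ hu.ennreal_ofReal hcbar]
      simp only [Pi.mul_apply, mul_comm]
    rw [aux (toM m2'), aux ((toM m2).const_mul lam)]
    refine lintegral_le_lintegral_of_measure_lt_le hcbar fun x => ?_
    rw [← tailInt_runHit P That hk hcbar (toM m2'),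
      ← tailInt_runHit (δ := fun ω t => lam * δ₂ ω t) P That hk hcbar ((toM m2).const_mul lam)]
    exact hchron _ (isStopTime_runHit hrc hThat hc x)
  rw [e1]
  refine (add_le_add e2 (e3.trans e4)).trans ?_
  unfold pairR
  rw [pairE_eq_lintegral_Pkappa P That hk hcm.ennreal_ofReal (toM m1),
    pairE_eq_lintegral_Pkappa P That hk hcbar ((toM m2).const_mul lam),
    pairE_eq_lintegral_Pkappa P That hk (hcm.ennreal_ofReal.max (hcbar.const_mul _)) (toM hδ),
    ← lintegral_add_left (by have := toM m1; fun_prop)]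
  refine lintegral_mono fun p => ?_
  rw [hsum, ENNReal.ofReal_add (h1 _ _) (h2 _ _), mul_add, ENNReal.ofReal_mul hlam,
    mul_left_comm, ← mul_assoc]
  gcongr
  · exact le_max_left _ _
  · exact le_max_right _ _

/-- The density, measurable for a sub-`σ`-algebra `m'`, of an integrable `Y`. -/
lemma exists_measurable_lintegral_mul_eq {α : Type*} {m' m₀ : MeasurableSpace α} (hm : m' ≤ m₀)
    (μ : Measure α) [IsFiniteMeasure μ] {Y : α → ℝ≥0∞} (hY : Measurable[m₀] Y)
    (hYfin : ∫⁻ a, Y a ∂μ ≠ ⊤) :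
    ∃ Z : α → ℝ, (∀ a, 0 ≤ Z a) ∧ Measurable[m'] Z ∧ ∀ g : α → ℝ≥0∞, Measurable[m'] g →
      ∫⁻ a, g a * ENNReal.ofReal (Z a) ∂μ = ∫⁻ a, g a * Y a ∂μ := by
  have : IsFiniteMeasure (μ.withDensity Y) := isFiniteMeasure_withDensity hYfin
  have hac : (μ.withDensity Y).trim hm ≪ μ.trim hm :=
    (withDensity_absolutelyContinuous μ Y).trim hm
  let d := ((μ.withDensity Y).trim hm).rnDeriv (μ.trim hm)
  have hd : Measurable[m'] d := Measure.measurable_rnDeriv _ _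
  refine ⟨fun a => (d a).toReal, fun a => ENNReal.toReal_nonneg, hd.ennreal_toReal,
    fun g hg => ?_⟩
  have hZ : Measurable[m'] fun a => g a * ENNReal.ofReal (d a).toReal :=
    hg.mul hd.ennreal_toReal.ennreal_ofReal
  rw [← lintegral_trim hm hZ]
  have h1 : ∫⁻ a, g a * ENNReal.ofReal (d a).toReal ∂(μ.trim hm) =
      ∫⁻ a, d a * g a ∂(μ.trim hm) := by
    refine lintegral_congr_ae ((Measure.rnDeriv_lt_top ((μ.withDensity Y).trim hm)
      (μ.trim hm)).mono fun a ha => ?_)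
    change g a * ENNReal.ofReal (d a).toReal = d a * g a
    rw [ENNReal.ofReal_toReal (ne_of_lt ha), mul_comm]
  rw [h1, lintegral_rnDeriv_mul hac hg.aemeasurable, lintegral_trim hm hg,
    lintegral_withDensity_eq_lintegral_mul _ hY (hg.mono hm le_rfl)]
  simp only [Pi.mul_apply, mul_comm]

lemma isFiniteMeasure_Pkappa [MeasurableSpace Ω] (P : Measure Ω) [IsFiniteMeasure P]
    (That : EReal) {kdot : Ω → ℝ → ℝ} (hk : Measurable fun p : Ω × ℝ => kdot p.1 p.2) {A : ℝ}
    (hkbdd : ∀ ω, (∫⁻ t in timeSet That, ENNReal.ofReal (kdot ω t)) ≤ ENNReal.ofReal A) :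
    IsFiniteMeasure (Pkappa P That kdot) := by
  refine ⟨?_⟩
  rw [← lintegral_one, lintegral_Pkappa P That hk measurable_const]
  simp only [one_mul]
  refine (lintegral_mono hkbdd).trans_lt ?_
  rw [lintegral_const]
  exact ENNReal.mul_lt_top ENNReal.ofReal_lt_top (measure_lt_top _ _)

/-- Mass `ρ` can be moved backwards in time, in a nonanticipative way, onto the times at which
`c` exceeds the threshold `L`, provided `L` lies below the running essential supremum. -/
lemma exists_transport {m : MeasurableSpace Ω} (P : Measure Ω) [IsProbabilityMeasure P]
    (ℱ : Filtration ℝ m) (That : EReal)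
    {kdot : Ω → ℝ → ℝ} (hk : Measurable fun p : Ω × ℝ => kdot p.1 p.2)
    (hkpos : ∀ ω, ∀ t ∈ timeSet That, 0 < kdot ω t) {A : ℝ}
    (hkbdd : ∀ ω, (∫⁻ t in timeSet That, ENNReal.ofReal (kdot ω t)) ≤ ENNReal.ofReal A)
    {c : Ω → ℝ → ℝ} (hc : IsStronglyProgressive ℱ (fun t ω => c ω t))
    {ρ L : Ω × ℝ → ℝ≥0∞} (hρ : Measurable ρ) (hρfin : ∫⁻ p, ρ p ∂(Pkappa P That kdot) ≠ ⊤)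
    (hL : Measurable L) (hLlt : ∀ ω t, L (ω, t) = 0 ∨ L (ω, t) < runEssSup (c ω) t) :
    ∃ Z : Ω → ℝ → ℝ, (∀ ω t, 0 ≤ Z ω t) ∧ IsStronglyProgressive ℱ (fun t ω => Z ω t) ∧
      (∀ T, IsStopTime ℱ That T → tailInt P That kdot Z T ≤
        ∫⁻ p in {p : Ω × ℝ | T p.1 ≤ (p.2 : EReal)}, ρ p ∂(Pkappa P That kdot)) ∧
      ∫⁻ p, L p * ρ p ∂(Pkappa P That kdot) ≤ pairR P That kdot c Z := by
  classical
  set μ := Pkappa P That kdot with hμ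
  have : IsFiniteMeasure μ := isFiniteMeasure_Pkappa P That hk hkbdd
  have hcP := isStronglyProgressive_iff_measurable_progSigma.1 hc
  have hcm : Measurable fun p : Ω × ℝ => c p.1 p.2 := hcP.mono (progSigma_le ℱ) le_rfl
  let K : (Ω × ℝ) × ℝ → ℝ≥0∞ :=
    {x | x.2 ≤ x.1.2 ∧ L x.1 < ENNReal.ofReal (c x.1.1 x.2)}.indicator 1
  have hcK : Measurable fun x : (Ω × ℝ) × ℝ => c x.1.1 x.2 :=
    hcm.comp ((measurable_fst.comp measurable_fst).prodMk measurable_snd)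
  have hkK : Measurable fun x : (Ω × ℝ) × ℝ => kdot x.1.1 x.2 :=
    hk.comp ((measurable_fst.comp measurable_fst).prodMk measurable_snd)
  have hKset : MeasurableSet
      {x : (Ω × ℝ) × ℝ | x.2 ≤ x.1.2 ∧ L x.1 < ENNReal.ofReal (c x.1.1 x.2)} :=
    (measurableSet_le measurable_snd (measurable_snd.comp measurable_fst)).inter
      (measurableSet_lt (hL.comp measurable_fst) hcK.ennreal_ofReal)
  have hK : Measurable K := measurable_one.indicator hKset
  let G : Ω × ℝ → ℝ≥0∞ := fun p =>
    ∫⁻ s in timeSet That, K (p, s) * ENNReal.ofReal (kdot p.1 s)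
  have hG : Measurable G := (hK.mul hkK.ennreal_ofReal).lintegral_prod_right'
  let w : Ω × ℝ → ℝ≥0∞ := fun p => ρ p * (G p)⁻¹
  have hw : Measurable w := hρ.mul hG.inv
  let Y : Ω × ℝ → ℝ≥0∞ := fun p =>
    ∫⁻ t in timeSet That, w (p.1, t) * K ((p.1, t), p.2) * ENNReal.ofReal (kdot p.1 t)
  have hY : Measurable Y := by
    refine Measurable.lintegral_prod_right' (f := fun x : (Ω × ℝ) × ℝ =>
      w (x.1.1, x.2) * K ((x.1.1, x.2), x.1.2) * ENNReal.ofReal (kdot x.1.1 x.2)) ?_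
    fun_prop
  have hgK : ∀ g : Ω × ℝ → ℝ≥0∞, Measurable g → Measurable fun p : Ω × ℝ =>
      ∫⁻ s in timeSet That, g (p.1, s) * K (p, s) * ENNReal.ofReal (kdot p.1 s) := by
    intro g hg
    refine Measurable.lintegral_prod_right' (f := fun x : (Ω × ℝ) × ℝ =>
      g (x.1.1, x.2) * K x * ENNReal.ofReal (kdot x.1.1 x.2)) ?_
    fun_prop
  have hswap : ∀ g : Ω × ℝ → ℝ≥0∞, Measurable g → ∫⁻ p, g p * Y p ∂μ =
      ∫⁻ p, w p * (∫⁻ s in timeSet That,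
        g (p.1, s) * K (p, s) * ENNReal.ofReal (kdot p.1 s)) ∂μ := by
    intro g hg
    rw [hμ, lintegral_Pkappa (g := fun p => g p * Y p) P That hk (hg.mul hY),
      lintegral_Pkappa (g := fun p => w p * ∫⁻ s in timeSet That,
        g (p.1, s) * K (p, s) * ENNReal.ofReal (kdot p.1 s)) P That hk (hw.mul (hgK g hg))]
    refine lintegral_congr fun ω => ?_
    have e1 : ∀ s, g (ω, s) * Y (ω, s) * ENNReal.ofReal (kdot ω s) =
        ∫⁻ t in timeSet That, g (ω, s) * ENNReal.ofReal (kdot ω s) *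
          (w (ω, t) * K ((ω, t), s) * ENNReal.ofReal (kdot ω t)) := by
      intro s
      rw [lintegral_const_mul _ (by fun_prop)]
      ring
    have e2 : ∀ t, w (ω, t) * (∫⁻ s in timeSet That,
        g (ω, s) * K ((ω, t), s) * ENNReal.ofReal (kdot ω s)) * ENNReal.ofReal (kdot ω t) =
        ∫⁻ s in timeSet That, w (ω, t) * ENNReal.ofReal (kdot ω t) *
          (g (ω, s) * K ((ω, t), s) * ENNReal.ofReal (kdot ω s)) := by
      intro t
      rw [lintegral_const_mul _ (by fun_prop)]
      ring
    simp only [e1, e2]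
    rw [lintegral_lintegral_swap (by fun_prop)]
    refine lintegral_congr fun t => lintegral_congr fun s => ?_
    ring
  have hle : ∀ p, w p * G p ≤ ρ p := by
    intro p
    calc w p * G p = ρ p * ((G p)⁻¹ * G p) := mul_assoc _ _ _
      _ ≤ ρ p * 1 := by gcongr; exact ENNReal.inv_mul_le_one _
      _ = ρ p := mul_one _
  have hYfin : ∫⁻ p, Y p ∂μ ≠ ⊤ := by
    have := hswap 1 measurable_one
    simp only [Pi.one_apply, one_mul] at this
    rw [this]
    exact ne_top_of_le_ne_top hρfin (lintegral_mono hle)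
  obtain ⟨Z, hZ0, hZm, hZ⟩ := exists_measurable_lintegral_mul_eq (progSigma_le ℱ) μ hY hYfin
  have hZm' : Measurable Z := hZm.mono (progSigma_le ℱ) le_rfl
  refine ⟨fun ω t => Z (ω, t), fun ω t => hZ0 _,
    isStronglyProgressive_iff_measurable_progSigma.2 hZm, fun T hT => ?_, ?_⟩
  · have hS := hT.measurableSet_progSigma
    have hS' := progSigma_le ℱ _ hS
    set S := {p : Ω × ℝ | T p.1 ≤ (p.2 : EReal)}
    have h1 := hZ (S.indicator 1) ((@measurable_one ℝ≥0∞ (Ω × ℝ) _ (progSigma ℱ) _).indicator hS)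
    rw [hswap _ ((measurable_one (α := ℝ≥0∞)).indicator hS')] at h1
    rw [hT.tailInt_eq P hk hZm', ← lintegral_indicator hS', ← lintegral_indicator hS']
    calc _ = ∫⁻ p, S.indicator 1 p * ENNReal.ofReal (Z p) ∂μ := by
          refine lintegral_congr fun p => ?_
          by_cases hp : p ∈ S <;> simp [hp]
      _ ≤ _ := by
          rw [h1]
          refine lintegral_mono fun p => ?_
          by_cases hp : p ∈ S
          · rw [indicator_of_mem hp]
            refine le_trans ?_ (hle p)
            refine mul_le_mul_right (lintegral_mono fun s => ?_) _
            refine mul_le_mul_left ?_ _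
            by_cases hs : (p.1, s) ∈ S <;> simp [hs]
          · rw [indicator_of_notMem hp, nonpos_iff_eq_zero]
            have : ∀ s, S.indicator 1 (p.1, s) * K (p, s) = 0 := by
              intro s
              by_cases hs : s ≤ p.2
              · have : (p.1, s) ∉ S := fun h => hp (le_trans (show T p.1 ≤ (s : EReal) from h)
                  (EReal.coe_le_coe_iff.2 hs))
                simp [this]
              · have : K (p, s) = 0 := indicator_of_notMem (fun h => hs h.1) _
                simp [this]
            simp [this]
  · have h1 := hZ (fun p => ENNReal.ofReal (c p.1 p.2)) hcP.ennreal_ofReal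
    rw [hswap _ hcm.ennreal_ofReal] at h1
    rw [pairR, pairE_eq_lintegral_Pkappa P That hk hcm.ennreal_ofReal hZm', h1]
    rw [hμ, lintegral_Pkappa (g := fun p => L p * ρ p) P That hk (hL.mul hρ),
      lintegral_Pkappa (g := fun p => w p * ∫⁻ s in timeSet That,
        ENNReal.ofReal (c p.1 s) * K (p, s) * ENNReal.ofReal (kdot p.1 s)) P That hk
        (hw.mul (hgK _ hcm.ennreal_ofReal))]
    refine lintegral_mono fun ω => setLIntegral_mono' (measurableSet_timeSet That) fun t ht => ?_
    rcases hLlt ω t with h0 | hlt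
    · simp [h0]
    have hGtop : G (ω, t) ≠ ⊤ := by
      refine ne_top_of_le_ne_top ENNReal.ofReal_ne_top (le_trans (lintegral_mono fun s => ?_)
        (hkbdd ω))
      exact mul_le_of_le_one_left' (indicator_le_self' (fun _ _ => zero_le) _)
    have hGpos : G (ω, t) ≠ 0 := by
      intro h0
      rw [lintegral_eq_zero_iff (by fun_prop)] at h0
      have h0' := (ae_restrict_iff' (measurableSet_timeSet That)).1 h0
      have hpos := lt_runEssSupE_iff.1 hlt
      refine hpos.ne' (measure_mono_null ?_ (ae_iff.1 h0'))
      rintro s ⟨hs1, hs0, hst⟩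
      have hmem : s ∈ timeSet That :=
        ⟨hs0, lt_of_le_of_lt (EReal.coe_le_coe_iff.2 hst) ht.2⟩
      have hK1 : K ((ω, t), s) = 1 := by
        have h : s ≤ t ∧ L (ω, t) < ENNReal.ofReal (c ω s) := ⟨hst, hs1⟩
        exact indicator_of_mem (s := {x : (Ω × ℝ) × ℝ |
          x.2 ≤ x.1.2 ∧ L x.1 < ENNReal.ofReal (c x.1.1 x.2)}) h 1
      simp [hmem, hK1, hkpos ω s hmem]
    gcongr ?_ * _
    calc L (ω, t) * ρ (ω, t) = w (ω, t) * (L (ω, t) * G (ω, t)) := by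
          change _ = ρ (ω, t) * (G (ω, t))⁻¹ * _
          rw [mul_comm (L (ω, t)) (G (ω, t)), mul_assoc, ← mul_assoc _ (G (ω, t)),
            ENNReal.inv_mul_cancel hGpos hGtop, one_mul, mul_comm]
      _ ≤ _ := by
          gcongr
          rw [← lintegral_const_mul _ (by fun_prop)]
          refine lintegral_mono fun s => ?_
          rw [← mul_assoc]
          gcongr ?_ * _
          by_cases hs : ((ω, t), s) ∈
              {x : (Ω × ℝ) × ℝ | x.2 ≤ x.1.2 ∧ L x.1 < ENNReal.ofReal (c x.1.1 x.2)}
          · gcongr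
            exact hs.2.le
          · have : K ((ω, t), s) = 0 := indicator_of_notMem hs _
            simp [this]

/-- The thresholds `min n ((1 - 1/(n+1)) x)` increase to `x`, strictly from below. -/
def belowApprox (x : ℝ≥0∞) (n : ℕ) : ℝ≥0∞ :=
  min (n : ℝ≥0∞) ((1 - ((n : ℝ≥0∞) + 1)⁻¹) * x)

lemma belowApprox_eq_zero_or_lt (x : ℝ≥0∞) (n : ℕ) :
    belowApprox x n = 0 ∨ belowApprox x n < x := by
  rcases eq_or_ne x 0 with rfl | h0
  · simp [belowApprox]
  right
  rcases eq_or_ne x ⊤ with rfl | htop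
  · exact (min_le_left _ _).trans_lt (ENNReal.natCast_lt_top n)
  · refine (min_le_right _ _).trans_lt ?_
    have : (1 - ((n : ℝ≥0∞) + 1)⁻¹) < 1 :=
      ENNReal.sub_lt_self ENNReal.one_ne_top one_ne_zero (by simp)
    calc (1 - ((n : ℝ≥0∞) + 1)⁻¹) * x < 1 * x :=
          ENNReal.mul_lt_mul_left h0 htop this
      _ = x := one_mul x

lemma tendsto_belowApprox (x : ℝ≥0∞) : Tendsto (belowApprox x) atTop (nhds x) := by
  have h1 : Tendsto (fun n : ℕ => (1 - ((n : ℝ≥0∞) + 1)⁻¹)) atTop (nhds 1) := by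
    have h := (tendsto_add_atTop_iff_nat 1).2 ENNReal.tendsto_inv_nat_nhds_zero
    have h' := ENNReal.Tendsto.sub (tendsto_const_nhds (x := (1 : ℝ≥0∞))) h
      (Or.inl ENNReal.one_ne_top)
    simpa using h'
  have h2 := ENNReal.Tendsto.mul_const (b := x) h1 (Or.inl one_ne_zero)
  have h3 := ENNReal.tendsto_nat_nhds_top.min h2
  rwa [one_mul, min_eq_right le_top] at h3

lemma measurable_belowApprox (n : ℕ) : Measurable fun x => belowApprox x n :=
  measurable_const.min (measurable_id.const_mul _)

lemma pairE_max_le {m : MeasurableSpace Ω} (P : Measure Ω) [IsProbabilityMeasure P]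
    (ℱ : Filtration ℝ m) (That : EReal)
    {kdot : Ω → ℝ → ℝ} (hk : Measurable fun p : Ω × ℝ => kdot p.1 p.2)
    (hkpos : ∀ ω, ∀ t ∈ timeSet That, 0 < kdot ω t) {A : ℝ}
    (hkbdd : ∀ ω, (∫⁻ t in timeSet That, ENNReal.ofReal (kdot ω t)) ≤ ENNReal.ofReal A)
    {lam : ℝ} (hlam : 0 ≤ lam) {c : Ω → ℝ → ℝ}
    (hc : IsStronglyProgressive ℱ (fun t ω => c ω t)) {δ : Ω → ℝ → ℝ}
    (hδnn : ∀ ω t, 0 ≤ δ ω t) (hδ : IsStronglyProgressive ℱ (fun t ω => δ ω t))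
    {B : ℝ≥0∞} (hB : ∀ δ' : Ω → ℝ → ℝ, (∀ ω t, 0 ≤ δ' ω t) →
      IsStronglyProgressive ℱ (fun t ω => δ' ω t) → chronLElam P That kdot ℱ lam δ' δ →
      pairR P That kdot c δ' ≤ B) :
    pairE P That kdot
      (fun ω t => max (ENNReal.ofReal (c ω t)) (ENNReal.ofReal lam * runEssSup (c ω) t)) δ
      ≤ B := by
  set μ := Pkappa P That kdot with hμ
  have : IsFiniteMeasure μ := isFiniteMeasure_Pkappa P That hk hkbdd
  have hcP := isStronglyProgressive_iff_measurable_progSigma.1 hc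
  have hcm : Measurable fun p : Ω × ℝ => c p.1 p.2 := hcP.mono (progSigma_le ℱ) le_rfl
  have hδP := isStronglyProgressive_iff_measurable_progSigma.1 hδ
  have hδm : Measurable fun p : Ω × ℝ => δ p.1 p.2 := hδP.mono (progSigma_le ℱ) le_rfl
  have hbP := measurable_progSigma_runEssSup hc
  have hbm : Measurable fun p : Ω × ℝ => runEssSup (c p.1) p.2 :=
    hbP.mono (progSigma_le ℱ) le_rfl
  let D : Set (Ω × ℝ) :=
    {p | ENNReal.ofReal lam * runEssSup (c p.1) p.2 ≤ ENNReal.ofReal (c p.1 p.2)}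
  have hD : MeasurableSet[progSigma ℱ] D :=
    @measurableSet_le _ _ _ _ _ (progSigma ℱ) _ _ _ _ _ (hbP.const_mul _) hcP.ennreal_ofReal
  let δ₁ : Ω → ℝ → ℝ := fun ω t => D.indicator (fun p => δ p.1 p.2) (ω, t)
  let δ₂ : Ω → ℝ → ℝ := fun ω t => Dᶜ.indicator (fun p => δ p.1 p.2) (ω, t)
  have h₁ : ∀ ω t, 0 ≤ δ₁ ω t := fun ω t => indicator_nonneg (fun _ _ => hδnn _ _) _
  have h₂ : ∀ ω t, 0 ≤ δ₂ ω t := fun ω t => indicator_nonneg (fun _ _ => hδnn _ _) _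
  have m₁P : Measurable[progSigma ℱ] fun p : Ω × ℝ => δ₁ p.1 p.2 := hδP.indicator hD
  have m₂P : Measurable[progSigma ℱ] fun p : Ω × ℝ => δ₂ p.1 p.2 := hδP.indicator hD.compl
  have m₁ : Measurable fun p : Ω × ℝ => δ₁ p.1 p.2 := m₁P.mono (progSigma_le ℱ) le_rfl
  have m₂ : Measurable fun p : Ω × ℝ => δ₂ p.1 p.2 := m₂P.mono (progSigma_le ℱ) le_rfl
  let ρ : ℕ → Ω × ℝ → ℝ≥0∞ := fun n p => ENNReal.ofReal (lam * min (δ₂ p.1 p.2) n)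
  let L : ℕ → Ω × ℝ → ℝ≥0∞ := fun n p => belowApprox (runEssSup (c p.1) p.2) n
  have hρ : ∀ n, Measurable (ρ n) := fun n =>
    ((m₂.min measurable_const).const_mul lam).ennreal_ofReal
  have hL : ∀ n, Measurable (L n) := fun n => (measurable_belowApprox n).comp hbm
  have hρfin : ∀ n, ∫⁻ p, ρ n p ∂μ ≠ ⊤ := by
    intro n
    refine ne_top_of_le_ne_top (b := ∫⁻ _, ENNReal.ofReal (lam * n) ∂μ) ?_
      (lintegral_mono fun p => ?_)
    · rw [lintegral_const]
      exact ENNReal.mul_ne_top ENNReal.ofReal_ne_top (measure_ne_top _ _)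
    · exact ENNReal.ofReal_le_ofReal (mul_le_mul_of_nonneg_left (min_le_right _ _) hlam)
  have hstep : ∀ n, ∫⁻ p, (ENNReal.ofReal (c p.1 p.2) * ENNReal.ofReal (δ₁ p.1 p.2)
      + L n p * ρ n p) ∂μ ≤ B := by
    intro n
    obtain ⟨Z, hZ0, hZP, hZtail, hZpair⟩ := exists_transport P ℱ That hk hkpos hkbdd hc
      (hρ n) (hρfin n) (hL n) (fun ω t => belowApprox_eq_zero_or_lt _ n)
    have hZm : Measurable fun p : Ω × ℝ => Z p.1 p.2 :=
      (isStronglyProgressive_iff_measurable_progSigma.1 hZP).mono (progSigma_le ℱ) le_rfl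
    have hm₁ := isStronglyProgressive_iff_measurable_progSigma.2 m₁P
    have hm₂ := isStronglyProgressive_iff_measurable_progSigma.2 m₂P
    rw [lintegral_add_left (by fun_prop)]
    calc _ ≤ pairR P That kdot c δ₁ + pairR P That kdot c Z := by
          refine add_le_add ?_ hZpair
          rw [pairR, pairE_eq_lintegral_Pkappa P That hk hcm.ennreal_ofReal m₁]
      _ = pairR P That kdot c (fun ω t => δ₁ ω t + Z ω t) :=
          (pairR_add P That hk hcm m₁ hZm h₁ hZ0).symm
      _ ≤ B := by
          refine hB _ (fun ω t => add_nonneg (h₁ ω t) (hZ0 ω t)) (hm₁.add hZP)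
            ⟨δ₁, δ₂, δ₁, Z, h₁, h₂, h₁, hZ0, hm₁, hm₂, hm₁, hZP, fun ω t => ?_,
              fun ω t => rfl, ae_of_all _ fun p => le_rfl, fun T hT => ?_⟩
          · exact (congrFun (indicator_self_add_compl D fun p : Ω × ℝ => δ p.1 p.2) (ω, t)).symm
          · refine (hZtail T hT).trans ?_
            rw [hT.tailInt_eq P hk (m₂.const_mul lam)]
            exact lintegral_mono fun p => ENNReal.ofReal_le_ofReal
              (mul_le_mul_of_nonneg_left (min_le_left _ _) hlam)
  have hlim : ∀ p : Ω × ℝ,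
      max (ENNReal.ofReal (c p.1 p.2)) (ENNReal.ofReal lam * runEssSup (c p.1) p.2)
        * ENNReal.ofReal (δ p.1 p.2) =
      liminf (fun n => ENNReal.ofReal (c p.1 p.2) * ENNReal.ofReal (δ₁ p.1 p.2)
        + L n p * ρ n p) atTop := by
    intro p
    have hρlim : Tendsto (fun n => L n p * ρ n p) atTop
        (nhds (runEssSup (c p.1) p.2 * ENNReal.ofReal (lam * δ₂ p.1 p.2))) := by
      refine (ENNReal.Tendsto.mul_const (tendsto_belowApprox (runEssSup (c p.1) p.2))
        (Or.inr ENNReal.ofReal_ne_top)).congr' ?_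
      obtain ⟨N, hN⟩ := exists_nat_ge (δ₂ p.1 p.2)
      filter_upwards [eventually_ge_atTop N] with n hn
      have : δ₂ p.1 p.2 ≤ n := hN.trans (Nat.cast_le.2 hn)
      simp only [L, ρ, min_eq_left this]
    rw [(hρlim.const_add _).liminf_eq]
    by_cases hp : p ∈ D
    · have e1 : δ₁ p.1 p.2 = δ p.1 p.2 := indicator_of_mem hp _
      have e2 : δ₂ p.1 p.2 = 0 := indicator_of_notMem (notMem_compl_iff.2 hp) _
      rw [e1, e2, max_eq_left hp]
      simp
    · have e1 : δ₁ p.1 p.2 = 0 := indicator_of_notMem hp _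
      have e2 : δ₂ p.1 p.2 = δ p.1 p.2 := indicator_of_mem (mem_compl hp) _
      rw [e1, e2, max_eq_right (le_of_not_ge hp), ENNReal.ofReal_mul hlam]
      simp only [ENNReal.ofReal_zero, mul_zero, zero_add]
      ring
  rw [pairE_eq_lintegral_Pkappa P That hk (hcm.ennreal_ofReal.max (hbm.const_mul _)) hδm,
    lintegral_congr hlim]
  refine (lintegral_liminf_le fun n => by have := hL n; have := hρ n; fun_prop).trans ?_
  exact (liminf_le_liminf (Eventually.of_forall hstep)).trans (liminf_const B).le

/-- Key identity: for every `λ ∈ [0,1]` and nonnegative progressively measurable `c`, `δ`,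
`⟨c ∨ λc̄, δ⟩ = sup {⟨c,δ'⟩ : δ' nonnegative progressively measurable, δ' ⪯_λ δ}`. -/
theorem pair_modProc_eq_iSup_chronLElam
    {m : MeasurableSpace Ω} (P : Measure Ω) [IsProbabilityMeasure P]
    (ℱ : Filtration ℝ m)
    (hrc : ∀ t : ℝ, ℱ t = ⨅ s ∈ Set.Ioi t, ℱ s)
    (hcomplete : ∀ s : Set Ω, MeasurableSet s → P s = 0 → ∀ t : ℝ, MeasurableSet[ℱ t] s)
    (That : EReal) (hThat : 0 < That)
    (kdot : Ω → ℝ → ℝ) (hkprog : ProgMeasurable ℱ (fun t ω => kdot ω t))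
    (hkpos : ∀ ω, ∀ t ∈ timeSet That, 0 < kdot ω t)
    (A : ℝ) (hkbdd : ∀ ω, (∫⁻ t in timeSet That, ENNReal.ofReal (kdot ω t)) ≤ ENNReal.ofReal A)
    (lam : ℝ) (hlam : lam ∈ Set.Icc (0:ℝ) 1)
    (c : Ω → ℝ → ℝ) (hcnn : ∀ ω t, 0 ≤ c ω t)
    (hcprog : ProgMeasurable ℱ (fun t ω => c ω t))
    (δ : Ω → ℝ → ℝ) (hδnn : ∀ ω t, 0 ≤ δ ω t)
    (hδprog : ProgMeasurable ℱ (fun t ω => δ ω t)) :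
    pairE P That kdot
      (fun ω t => max (ENNReal.ofReal (c ω t)) (ENNReal.ofReal lam * runEssSup (c ω) t)) δ
      = ⨆ (δ' : Ω → ℝ → ℝ) (_ : (∀ ω t, 0 ≤ δ' ω t) ∧
          ProgMeasurable ℱ (fun t ω => δ' ω t) ∧ chronLElam P That kdot ℱ lam δ' δ),
        pairR P That kdot c δ' := by
  have hk : Measurable fun p : Ω × ℝ => kdot p.1 p.2 :=
    (isStronglyProgressive_iff_measurable_progSigma.1 hkprog).mono (progSigma_le ℱ) le_rfl
  refine le_antisymm ?_ ?_
  · exact pairE_max_le P ℱ That hk hkpos hkbdd hlam.1 hcprog hδnn hδprog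
      fun δ' h0 hm hle => le_iSup₂_of_le δ' ⟨h0, hm, hle⟩ le_rfl
  · exact iSup₂_le fun δ' h =>
      pairR_le_of_chronLElam P ℱ hrc That hThat.le hk hlam.1 hcprog hδprog h.2.2
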